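/- Let X be a compact metric space, let ν and ν₀ be Borel probability measures on X, let f : X → ℝ^m be Lipschitz with constant K_f, and let λ > 0. Suppose W ≥ 0 satisfies the Kantorovich bound: for every L ≥ 0 and every L-Lipschitz function g : X → ℝ, |∫_X g dν − ∫_X g dν₀| ≤ L·W. Then |∫_X exp(−λ‖f(x)‖²) dν(x) − ∫_X exp(−λ‖f(x)‖²) dν₀(x)| ≤ √λ·K_f·W. -/

import Mathlib

open MeasureTheory
open scoped NNReal

/-- The Gaussian `t ↦ exp(−t²)` is `1`-Lipschitz on `ℝ`. -/
theorem lipschitzWith_one_exp_neg_sq : LipschitzWith 1 fun t : ℝ => Real.exp (-t ^ 2) := by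
  have hderiv (t : ℝ) :
      HasDerivAt (fun t : ℝ => Real.exp (-t ^ 2)) (Real.exp (-t ^ 2) * -(2 * t)) t := by
    simpa using ((hasDerivAt_pow 2 t).neg).exp
  refine lipschitzWith_of_nnnorm_deriv_le (fun t => (hderiv t).differentiableAt) fun t => ?_
  have habs : 2 * |t| ≤ Real.exp (t ^ 2) := by
    nlinarith [Real.add_one_le_exp (t ^ 2), sq_nonneg (|t| - 1), sq_abs t]
  rw [← NNReal.coe_le_coe, coe_nnnorm, (hderiv t).deriv, Real.norm_eq_abs, abs_mul, abs_neg,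
    abs_mul, abs_two, Real.abs_exp, Real.exp_neg, NNReal.coe_one]
  exact inv_mul_le_one_of_le₀ habs (Real.exp_pos _).le

/-- The Gaussian levelset weight at scale `lam` of a `K`-Lipschitz map is `√lam * K`-Lipschitz. -/
theorem LipschitzWith.exp_neg_mul_norm_sq {X E : Type*} [PseudoMetricSpace X]
    [SeminormedAddCommGroup E] {f : X → E} {K : ℝ≥0} (hf : LipschitzWith K f)
    {lam : ℝ} (hlam : 0 ≤ lam) :
    LipschitzWith (NNReal.sqrt lam.toNNReal * K) fun x => Real.exp (-lam * ‖f x‖ ^ 2) := by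
  have hscale : LipschitzWith (NNReal.sqrt lam.toNNReal * K) fun x => √lam * ‖f x‖ := by
    refine LipschitzWith.of_dist_le_mul fun x y => ?_
    rw [Real.dist_eq, ← mul_sub, abs_mul, abs_of_nonneg (Real.sqrt_nonneg _), NNReal.coe_mul,
      Real.coe_sqrt, Real.coe_toNNReal _ hlam, mul_assoc]
    gcongr
    exact (abs_norm_sub_norm_le _ _).trans (by simpa [dist_eq_norm] using hf.dist_le_mul x y)
  simpa [Function.comp_def, mul_pow, Real.sq_sqrt hlam] using
    lipschitzWith_one_exp_neg_sq.comp hscale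

/-- If `ν, ν₀` are Borel probability measures on a compact metric space `X` satisfying the
Kantorovich bound with constant `W` (so `W` plays the role of `W₁(ν, ν₀)`), `f : X → ℝ^m` is
`K_f`-Lipschitz, and `λ > 0`, then the integrals of the Gaussian levelset weight
`x ↦ exp(−λ‖f(x)‖²)` against `ν` and `ν₀` differ by at most `√λ·K_f·W`. -/
theorem gaussian_levelset_weight_integral_close {X : Type*} [MetricSpace X] [CompactSpace X]
    [MeasurableSpace X] [BorelSpace X]
    (ν ν₀ : Measure X) [IsProbabilityMeasure ν] [IsProbabilityMeasure ν₀] {m : ℕ}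
    (f : X → EuclideanSpace ℝ (Fin m)) (Kf : ℝ≥0) (hf : LipschitzWith Kf f)
    (lam : ℝ) (hlam : 0 < lam) (W : ℝ) (hW : 0 ≤ W)
    (hKant : ∀ (L : ℝ≥0) (g : X → ℝ), LipschitzWith L g →
      |(∫ x, g x ∂ν) - ∫ x, g x ∂ν₀| ≤ (L : ℝ) * W) :
    |(∫ x, Real.exp (-lam * ‖f x‖ ^ 2) ∂ν) - ∫ x, Real.exp (-lam * ‖f x‖ ^ 2) ∂ν₀|
      ≤ Real.sqrt lam * Kf * W := by
  simpa [Real.coe_toNNReal _ hlam.le] using hKant _ _ (hf.exp_neg_mul_norm_sq hlam.le)
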